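/- Let S be a k-dimensional F_q-subspace of F and let C = Orb(S). If ω_{2i}(C) > 0 for some i ∈ {1,…,k}, then k ≡ i (mod [H(S) : F_q]). -/

import Mathlib

open Module

section Defs

variable {F : Type*} [Field F]

/-- The subspace `α·S = {α * s : s ∈ S}` of `F`, for `S` a subspace over the subfield `Fq`. -/
noncomputable def smulSub (Fq : Subfield F) (α : F) (S : Submodule Fq F) : Submodule Fq F :=
  S.map (LinearMap.mulLeft Fq α)

/-- The one-orbit cyclic subspace code `Orb(S) = {αS : α ∈ Fˣ}`. -/
def Orb (Fq : Subfield F) (S : Submodule Fq F) : Set (Submodule Fq F) :=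
  {T | ∃ α : F, α ≠ 0 ∧ T = smulSub Fq α S}

/-- The number of subspaces `αS` (for `α ∈ Fˣ`) with `dim_{Fq}(S ∩ αS) = d`.
For `dim_{Fq} S = k` and `d = k - i` this is the weight-distribution entry `ω_{2i}(Orb S)`. -/
noncomputable def wt (Fq : Subfield F) (S : Submodule Fq F) (d : ℕ) : ℕ :=
  Set.ncard {T | T ∈ Orb Fq S ∧ finrank Fq ↥(S ⊓ T) = d}

/-- The stabilizer `H(V) = {x ∈ Fˣ : xV = V} ∪ {0}` of a set `V ⊆ F`. -/
def HStabSet (V : Set F) : Set F :=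
  {x : F | x ≠ 0 ∧ (fun y => x * y) '' V = V} ∪ {0}

/-- An `Fqt`-subspace of `F` viewed as an `Fq`-subspace, for `Fq ≤ Fqt`. -/
def toFqSub (Fq Fqt : Subfield F) (h : Fq ≤ Fqt) (W : Submodule Fqt F) : Submodule Fq F where
  carrier := W
  add_mem' := fun ha hb => W.add_mem ha hb
  zero_mem' := W.zero_mem
  smul_mem' := fun c _ hx => W.smul_mem (⟨c.1, h c.2⟩ : Fqt) hx

/-- The subfield `Fqt` viewed as an `Fq`-subspace of `F`, for `Fq ≤ Fqt`. -/
def subfieldModule (Fq Fqt : Subfield F) (h : Fq ≤ Fqt) : Submodule Fq F where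
  carrier := Fqt
  add_mem' := fun ha hb => Fqt.add_mem ha hb
  zero_mem' := Fqt.zero_mem
  smul_mem' := fun c _ hx => Fqt.mul_mem (h c.2) hx

/-- `Orb(S)` is an `r`-FWS code, where `k = dim_{Fq} S`: the weight-distribution entries
`ω_{2i}` are positive for `i ∈ {1, …, k - r}` and zero for `i ∈ {k - r + 1, …, k}`. -/
def IsRFWS (Fq : Subfield F) (S : Submodule Fq F) (k r : ℕ) : Prop :=
  (∀ i, 1 ≤ i → i ≤ k - r → 0 < wt Fq S (k - i)) ∧
  (∀ i, k - r + 1 ≤ i → i ≤ k → wt Fq S (k - i) = 0)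

end Defs

section Stabilizer

variable {F : Type*} [Field F] {Fq : Subfield F}

theorem mem_smulSub {α x : F} {S : Submodule Fq F} :
    x ∈ smulSub Fq α S ↔ ∃ s ∈ S, α * s = x := by
  simp [smulSub]

theorem smulSub_mul (α β : F) (S : Submodule Fq F) :
    smulSub Fq (α * β) S = smulSub Fq α (smulSub Fq β S) := by
  ext x
  simp [mem_smulSub, mul_assoc]

theorem smulSub_one (S : Submodule Fq F) : smulSub Fq 1 S = S := by
  ext x
  simp [mem_smulSub]

theorem mem_HStabSet_iff {S : Submodule Fq F} {x : F} (hx : x ≠ 0) :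
    x ∈ HStabSet (S : Set F) ↔ smulSub Fq x S = S := by
  rw [← SetLike.coe_set_eq]
  simp only [HStabSet, smulSub, Set.union_singleton, Set.mem_insert_iff, hx, Set.mem_ofPred_eq, ne_eq,
    not_false_eq_true, true_and, false_or, Submodule.map_coe]
  rfl

theorem mul_mem_of_mem_HStabSet {S : Submodule Fq F} {x y : F}
    (hx : x ∈ HStabSet (S : Set F)) (hy : y ∈ S) : x * y ∈ S := by
  rcases hx with ⟨-, hx⟩ | rfl
  · have : x * y ∈ (fun y => x * y) '' (S : Set F) := ⟨y, hy, rfl⟩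
    rwa [hx] at this
  · simp

theorem div_mem_HStabSet {S : Submodule Fq F} {β γ : F} (hβ : β ≠ 0) (hγ : γ ≠ 0)
    (h : smulSub Fq β S = smulSub Fq γ S) : β / γ ∈ HStabSet (S : Set F) := by
  rw [mem_HStabSet_iff (div_ne_zero hβ hγ), div_eq_inv_mul, smulSub_mul, h, ← smulSub_mul,
    inv_mul_cancel₀ hγ, smulSub_one]

/-- The intersection `S ∩ αS` is isomorphic to `{s ∈ S : αs ∈ S}`. -/
theorem finrank_inf_smulSub {α : F} (hα : α ≠ 0) (S : Submodule Fq F) :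
    finrank Fq ↥(S ⊓ smulSub Fq α S) =
      finrank Fq ↥(S.comap (LinearMap.mulLeft Fq α) ⊓ S) := by
  have h : S ⊓ smulSub Fq α S =
      (S.comap (LinearMap.mulLeft Fq α) ⊓ S).map (LinearMap.mulLeft Fq α) := by
    ext x
    simp only [Submodule.mem_inf, mem_smulSub, Submodule.mem_map, Submodule.mem_comap,
      LinearMap.mulLeft_apply]
    constructor
    · rintro ⟨hx, s, hs, rfl⟩
      exact ⟨s, ⟨hx, hs⟩, rfl⟩
    · rintro ⟨s, ⟨hx, hs⟩, rfl⟩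
      exact ⟨hx, s, hs, rfl⟩
  rw [h]
  exact (Submodule.equivMapOfInjective _ (mul_right_injective₀ hα) _).finrank_eq.symm

/-- Translating `α` by a scalar does not change `dim (S ∩ αS)`. -/
theorem finrank_inf_smulSub_add {α : F} (hα : α ≠ 0) (S : Submodule Fq F) (c : Fq)
    (hc : α + c ≠ 0) :
    finrank Fq ↥(S ⊓ smulSub Fq (α + c) S) = finrank Fq ↥(S ⊓ smulSub Fq α S) := by
  have h : S.comap (LinearMap.mulLeft Fq (α + c)) ⊓ S =
      S.comap (LinearMap.mulLeft Fq α) ⊓ S := by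
    ext x
    simp only [Submodule.mem_inf, Submodule.mem_comap, LinearMap.mulLeft_apply, add_mul]
    refine and_congr_left fun hx => ?_
    exact S.add_mem_iff_left (S.smul_mem c hx)
  rw [finrank_inf_smulSub hα, finrank_inf_smulSub hc, h]

/-- Over an infinite base field, if only finitely many members of `Orb S` meet `S` in the same
dimension as `αS` does, then `α` stabilizes `S`. -/
theorem mem_stabilizer_of_wt_pos [Infinite Fq] {S : Submodule Fq F} {HS : Subfield F}
    (hle : Fq ≤ HS) (hHS : (HS : Set F) = HStabSet (S : Set F)) {m : ℕ} (hpos : 0 < wt Fq S m)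
    {α : F} (hα : α ≠ 0) (hm : finrank Fq ↥(S ⊓ smulSub Fq α S) = m) : α ∈ HS := by
  by_contra hαH
  have hne (c : Fq) : α + c ≠ 0 := fun h =>
    hαH (by rw [eq_neg_of_add_eq_zero_left h]; exact neg_mem (hle c.2))
  refine Set.not_injOn_infinite_finite_image (f := fun c : Fq => smulSub Fq (α + c) S)
    Set.infinite_univ ((Set.finite_of_ncard_pos hpos).subset ?_) ?_
  · rintro _ ⟨c, -, rfl⟩
    exact ⟨⟨_, hne c, rfl⟩, (finrank_inf_smulSub_add hα S c (hne c)).trans hm⟩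
  · intro c _ c' _ h
    have hH : (α + c) / (α + c') ∈ HS := by
      rw [← SetLike.mem_coe, hHS]
      exact div_mem_HStabSet (hne c) (hne c') h
    set t := (α + c) / (α + c')
    have ht : t * (α + c') = α + c := div_mul_cancel₀ _ (hne c')
    by_cases h1 : t = 1
    · rw [h1] at ht
      exact Subtype.ext (by linear_combination -ht)
    · refine absurd ?_ hαH
      have : α = (t * c' - c) / (1 - t) := by
        rw [eq_div_iff (sub_ne_zero.2 (Ne.symm h1))]
        linear_combination -ht
      rw [this]
      exact div_mem (sub_mem (mul_mem hH (hle c'.2)) (hle c.2)) (sub_mem (one_mem _) hH)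

/-- The dimension of a finite space stable under a larger field of size `q ^ d` is a multiple
of `d`. -/
theorem dvd_finrank_of_smul_mem [Finite F] (HS : Subfield F) {d : ℕ}
    (hd : Nat.card HS = Nat.card Fq ^ d) (V : Submodule Fq F)
    (hV : ∀ x ∈ HS, ∀ y ∈ V, x * y ∈ V) : d ∣ finrank Fq V := by
  let W : Submodule HS F :=
    { V.toAddSubmonoid with smul_mem' := fun c _ hx => hV c c.2 _ hx }
  have h : Nat.card V = Nat.card W := rfl
  rw [Module.natCard_eq_pow_finrank (K := Fq) (V := V),
    Module.natCard_eq_pow_finrank (K := HS) (V := W), hd, ← pow_mul] at h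
  exact ⟨_, Nat.pow_right_injective (Finite.one_lt_card (α := Fq)) h⟩

end Stabilizer

/-- if `ω_{2i}(Orb S) > 0` for some `i ∈ {1, …, k}`, then
`k ≡ i (mod [H(S) : F_q])`, where `[H(S) : F_q] = d` is the degree of the stabilizer
subfield `H(S)` over `F_q` (so `|H(S)| = q^d`). -/
theorem stmt17 (q n : ℕ) (hn : 0 < n)
    (F : Type*) [Field F] (hF : Nat.card F = q ^ n)
    (Fq : Subfield F) (hq : Nat.card Fq = q)
    (S : Submodule Fq F) (k : ℕ) (hk : finrank Fq S = k)
    (HS : Subfield F) (hle : Fq ≤ HS) (hHS : (HS : Set F) = HStabSet (S : Set F))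
    (d : ℕ) (hd : Nat.card HS = q ^ d)
    (i : ℕ) (hi1 : 1 ≤ i) (hi2 : i ≤ k)
    (hpos : 0 < wt Fq S (k - i)) :
    k ≡ i [MOD d] := by
  subst hq
  subst hk
  obtain ⟨_, ⟨α, hα, rfl⟩, hT⟩ := Set.nonempty_of_ncard_ne_zero hpos.ne'
  have hmul : ∀ x ∈ HS, ∀ y ∈ S, x * y ∈ S := fun x hx y hy =>
    mul_mem_of_mem_HStabSet (hHS ▸ hx : x ∈ HStabSet (S : Set F)) hy
  rcases finite_or_infinite Fq with hfin | hinf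
  · have : Finite F := Nat.finite_of_card_ne_zero
      (by rw [hF]; exact pow_ne_zero _ Nat.card_pos.ne')
    have h : d ∣ finrank Fq ↥(S ⊓ smulSub Fq α S) := by
      refine dvd_finrank_of_smul_mem HS hd _ fun x hx y hy => ?_
      obtain ⟨hyS, hyT⟩ := hy
      obtain ⟨s, hs, rfl⟩ := mem_smulSub.1 hyT
      exact ⟨hmul x hx _ hyS, mem_smulSub.2 ⟨x * s, hmul x hx s hs, by ring⟩⟩
    rw [hT] at h
    exact ((Nat.modEq_iff_dvd' hi2).2 h).symm
  · have hαH := mem_stabilizer_of_wt_pos hle hHS hpos hα hT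
    rw [← SetLike.mem_coe, hHS, mem_HStabSet_iff hα] at hαH
    rw [hαH, inf_idem] at hT
    omega
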